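/- arXiv:2405.15903 — 5 statements merged into one kernel-verified Lean document; each statement's English description precedes it below -/
import Mathlib

section
/- Let X ~ N(μx, σx²) and Y ~ N(μy, σy²) be independent real Gaussian random variables with σx, σy > 0, let Z := X·Y − μx·μy, and set b := 2√6·σx·σy + √(8/(3·log 2))·(σy·|μx| + σx·|μy|). Then E[exp(|Z| / b)] ≤ 2. -/
open MeasureTheory ProbabilityTheory

/-- A standard Gaussian `G` satisfies `E[exp(3 G² / 8)] = 2`. -/
lemma integral_exp_sq_gaussianReal :
    ∫ x, Real.exp (3 / 8 * x ^ 2) ∂gaussianReal 0 1 = 2 := by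
  have h : ∀ x : ℝ, gaussianPDFReal 0 1 x • Real.exp (3 / 8 * x ^ 2)
      = (√(2 * Real.pi))⁻¹ * Real.exp (-(1 / 8) * x ^ 2) := by
    intro x
    simp only [gaussianPDFReal, smul_eq_mul, NNReal.coe_one, mul_one, sub_zero]
    rw [mul_assoc, ← Real.exp_add]
    ring_nf
  rw [integral_gaussianReal_eq_integral_smul one_ne_zero]
  simp_rw [h]
  rw [integral_const_mul, integral_gaussian]
  have hpi : √(Real.pi / (1 / 8)) = 2 * √(2 * Real.pi) := by
    rw [show Real.pi / (1 / 8) = 2 ^ 2 * (2 * Real.pi) by ring,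
      Real.sqrt_mul (by positivity), Real.sqrt_sq (by norm_num)]
  have hne : √(2 * Real.pi) ≠ 0 := by positivity
  rw [hpi]
  field_simp

/-- If `X ~ N(m, s²)` then its standardization `G` satisfies `E[exp(3 G² / 8)] = 2`. -/
lemma integral_exp_sq_standardized {Ω : Type*} [MeasurableSpace Ω] {P : Measure Ω}
    {X : Ω → ℝ} {m s : ℝ} (hs : 0 < s) (hmX : Measurable X)
    (hX : P.map X = gaussianReal m (s ^ 2).toNNReal) :
    ∫ ω, Real.exp (3 / 8 * ((X ω - m) / s) ^ 2) ∂P = 2 := by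
  have hlaw : HasLaw X (gaussianReal m (s ^ 2).toNNReal) P := ⟨hmX.aemeasurable, hX⟩
  have hstd := gaussianReal_div_const (gaussianReal_sub_const hlaw m) s
  have hvar : (s ^ 2).toNNReal / NNReal.mk (s ^ 2) (sq_nonneg s) = 1 := by
    rw [Real.toNNReal_of_nonneg (sq_nonneg s)]
    exact div_self (by rw [Ne, ← NNReal.coe_eq_zero]; exact (pow_pos hs 2).ne')
  rw [sub_self, zero_div, hvar] at hstd
  rw [← integral_exp_sq_gaussianReal, ← hstd.map_eq,
    integral_map hstd.aemeasurable (by fun_prop)]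

/-- The exponential of a midpoint is at most the mean of the exponentials. -/
lemma exp_midpoint_le (u v : ℝ) :
    Real.exp ((u + v) / 2) ≤ (Real.exp u + Real.exp v) / 2 := by
  have h := convexOn_exp.2 (Set.mem_univ u) (Set.mem_univ v)
    (one_half_pos (α := ℝ)).le one_half_pos.le (by norm_num)
  simp only [smul_eq_mul] at h
  calc Real.exp ((u + v) / 2) = Real.exp (1 / 2 * u + 1 / 2 * v) := by ring_nf
    _ ≤ _ := h
    _ = _ := by ring

lemma exp_abs_mul_div_le (g h : ℝ) :
    Real.exp (|g * h| / (2 * √6))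
      ≤ (Real.exp (3 / 8 * g ^ 2) + Real.exp (3 / 8 * h ^ 2)) / 2 := by
  refine le_trans (Real.exp_le_exp.2 ?_) (exp_midpoint_le _ _)
  have h6 : (2 : ℝ) ≤ √6 := Real.le_sqrt_of_sq_le (by norm_num)
  rw [div_le_iff₀ (by positivity), abs_mul]
  have hgh : 2 * (|g| * |h|) ≤ g ^ 2 + h ^ 2 := by
    nlinarith [sq_nonneg (|g| - |h|), sq_abs g, sq_abs h]
  nlinarith [mul_nonneg (abs_nonneg g) (abs_nonneg h), sq_nonneg g, sq_nonneg h]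

lemma exp_abs_div_le (g : ℝ) :
    Real.exp (|g| / √(8 / (3 * Real.log 2))) ≤ (2 + Real.exp (3 / 8 * g ^ 2)) / 2 := by
  have hlog : 0 < Real.log 2 := Real.log_pos (by norm_num)
  set c := √(8 / (3 * Real.log 2)) with hc
  have hc0 : 0 < c := by positivity
  have hc2 : Real.log 2 = 8 / 3 / c ^ 2 := by
    rw [hc, Real.sq_sqrt (by positivity)]
    field_simp
  have hle : |g| / c ≤ (Real.log 2 + 3 / 8 * g ^ 2) / 2 := by
    rw [hc2, ← sq_abs g, div_eq_mul_inv, div_eq_mul_inv _ (c ^ 2), ← inv_pow]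
    nlinarith [sq_nonneg (8 / 3 * c⁻¹ - |g|)]
  calc Real.exp (|g| / c) ≤ Real.exp ((Real.log 2 + 3 / 8 * g ^ 2) / 2) := Real.exp_le_exp.2 hle
    _ ≤ _ := exp_midpoint_le _ _
    _ = _ := by rw [Real.exp_log (by norm_num)]

/-- A weighted form of the convexity of `exp`, for three terms. -/
lemma exp_weighted_sum_div_le {a₁ a₂ a₃ u₁ u₂ u₃ : ℝ} (h₁ : 0 < a₁) (h₂ : 0 ≤ a₂) (h₃ : 0 ≤ a₃) :
    Real.exp ((a₁ * u₁ + a₂ * u₂ + a₃ * u₃) / (a₁ + a₂ + a₃))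
      ≤ (a₁ * Real.exp u₁ + a₂ * Real.exp u₂ + a₃ * Real.exp u₃) / (a₁ + a₂ + a₃) := by
  have hs : 0 < a₁ + a₂ + a₃ := by positivity
  have h := convexOn_exp.map_sum_le (t := Finset.univ)
    (w := ![a₁ / (a₁ + a₂ + a₃), a₂ / (a₁ + a₂ + a₃), a₃ / (a₁ + a₂ + a₃)])
    (p := ![u₁, u₂, u₃])
    (by intro i _; fin_cases i <;> simp <;> positivity)
    (by simp [Fin.sum_univ_three]; field_simp)
    (by simp)
  simp only [Fin.sum_univ_three, smul_eq_mul, Matrix.cons_val] at h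
  calc Real.exp ((a₁ * u₁ + a₂ * u₂ + a₃ * u₃) / (a₁ + a₂ + a₃))
      = Real.exp (a₁ / (a₁ + a₂ + a₃) * u₁ + a₂ / (a₁ + a₂ + a₃) * u₂
          + a₃ / (a₁ + a₂ + a₃) * u₃) := by ring_nf
    _ ≤ _ := h
    _ = _ := by ring

/-- The sub-exponential (ψ₁) moment bound for the centered product of two
independent Gaussians: with `b = 2√6·σx·σy + √(8/(3 log 2))·(σy|μx| + σx|μy|)`,
`E[exp(|XY − μx·μy| / b)] ≤ 2`. -/
theorem gaussian_product_psi1_bound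
    {Ω : Type*} [MeasureSpace Ω] [IsProbabilityMeasure (ℙ : Measure Ω)]
    (μx μy σx σy : ℝ) (hσx : 0 < σx) (hσy : 0 < σy)
    (X Y : Ω → ℝ) (hmX : Measurable X) (hmY : Measurable Y)
    (hindep : IndepFun X Y ℙ)
    (hX : Measure.map X ℙ = gaussianReal μx ((σx ^ 2).toNNReal))
    (hY : Measure.map Y ℙ = gaussianReal μy ((σy ^ 2).toNNReal))
    (b : ℝ)
    (hb : b = 2 * Real.sqrt 6 * σx * σy
        + Real.sqrt (8 / (3 * Real.log 2)) * (σy * |μx| + σx * |μy|)) :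
    ∫ ω, Real.exp (|X ω * Y ω - μx * μy| / b) ∂ℙ ≤ 2 := by
  have hIX := integral_exp_sq_standardized hσx hmX hX
  have hIY := integral_exp_sq_standardized hσy hmY hY
  have hintX := not_imp_comm.1 integral_undef (hIX.trans_ne two_ne_zero)
  have hintY := not_imp_comm.1 integral_undef (hIY.trans_ne two_ne_zero)
  set A : Ω → ℝ := fun ω ↦ Real.exp (3 / 8 * ((X ω - μx) / σx) ^ 2) with hA
  set B : Ω → ℝ := fun ω ↦ Real.exp (3 / 8 * ((Y ω - μy) / σy) ^ 2) with hB
  have hlog : 0 < Real.log 2 := Real.log_pos (by norm_num)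
  have hc0 : 0 < √(8 / (3 * Real.log 2)) := by positivity
  obtain ⟨a₁, ha₁⟩ : ∃ a, a = 2 * √6 * σx * σy := ⟨_, rfl⟩
  obtain ⟨a₂, ha₂⟩ : ∃ a, a = √(8 / (3 * Real.log 2)) * (σy * |μx|) := ⟨_, rfl⟩
  obtain ⟨a₃, ha₃⟩ : ∃ a, a = √(8 / (3 * Real.log 2)) * (σx * |μy|) := ⟨_, rfl⟩
  have h₁ : 0 < a₁ := by rw [ha₁]; positivity
  have h₂ : 0 ≤ a₂ := by rw [ha₂]; positivity
  have h₃ : 0 ≤ a₃ := by rw [ha₃]; positivity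
  have hba : b = a₁ + a₂ + a₃ := by rw [hb, ha₁, ha₂, ha₃]; ring
  have hb0 : 0 < b := by rw [hba]; positivity
  have hpt : ∀ ω, Real.exp (|X ω * Y ω - μx * μy| / b)
      ≤ (a₂ + a₃) / b + (a₁ + a₃) / (2 * b) * A ω + (a₁ + a₂) / (2 * b) * B ω := by
    intro ω
    obtain ⟨g, hg⟩ : ∃ g, g = (X ω - μx) / σx := ⟨_, rfl⟩
    obtain ⟨h, hh⟩ : ∃ h, h = (Y ω - μy) / σy := ⟨_, rfl⟩
    have hX' : X ω = μx + σx * g := by rw [hg]; field_simp; ring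
    have hY' : Y ω = μy + σy * h := by rw [hh]; field_simp; ring
    have habs : |X ω * Y ω - μx * μy| ≤ a₁ * (|g * h| / (2 * √6))
        + a₂ * (|h| / √(8 / (3 * Real.log 2))) + a₃ * (|g| / √(8 / (3 * Real.log 2))) := by
      calc |X ω * Y ω - μx * μy|
          = |σx * σy * (g * h) + σy * μx * h + σx * μy * g| := by rw [hX', hY']; ring_nf
        _ ≤ |σx * σy * (g * h)| + |σy * μx * h| + |σx * μy * g| := abs_add_three _ _ _
        _ = σx * σy * |g * h| + σy * |μx| * |h| + σx * |μy| * |g| := by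
          simp only [abs_mul, abs_of_pos hσx, abs_of_pos hσy]
        _ = _ := by rw [ha₁, ha₂, ha₃]; field_simp
    calc Real.exp (|X ω * Y ω - μx * μy| / b)
        ≤ Real.exp ((a₁ * (|g * h| / (2 * √6)) + a₂ * (|h| / √(8 / (3 * Real.log 2)))
            + a₃ * (|g| / √(8 / (3 * Real.log 2)))) / b) := by gcongr
      _ ≤ (a₁ * Real.exp (|g * h| / (2 * √6)) + a₂ * Real.exp (|h| / √(8 / (3 * Real.log 2)))
            + a₃ * Real.exp (|g| / √(8 / (3 * Real.log 2)))) / b := by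
          rw [hba]; exact exp_weighted_sum_div_le h₁ h₂ h₃
      _ ≤ (a₁ * ((A ω + B ω) / 2) + a₂ * ((2 + B ω) / 2) + a₃ * ((2 + A ω) / 2)) / b := by
          simp only [hA, hB, ← hg, ← hh]
          gcongr
          · exact exp_abs_mul_div_le g h
          · exact exp_abs_div_le h
          · exact exp_abs_div_le g
      _ = _ := by field_simp; ring
  have hiA := hintX.const_mul ((a₁ + a₃) / (2 * b))
  have hiB := hintY.const_mul ((a₁ + a₂) / (2 * b))
  have hiCA : Integrable (fun ω ↦ (a₂ + a₃) / b + (a₁ + a₃) / (2 * b) * A ω) ℙ :=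
    (integrable_const _).add hiA
  calc ∫ ω, Real.exp (|X ω * Y ω - μx * μy| / b) ∂ℙ
      ≤ ∫ ω, ((a₂ + a₃) / b + (a₁ + a₃) / (2 * b) * A ω + (a₁ + a₂) / (2 * b) * B ω) ∂ℙ :=
        integral_mono_of_nonneg (.of_forall fun _ ↦ (Real.exp_pos _).le) (hiCA.add hiB)
          (.of_forall hpt)
    _ = (a₂ + a₃) / b + (a₁ + a₃) / (2 * b) * 2 + (a₁ + a₂) / (2 * b) * 2 := by
        rw [integral_add hiCA hiB, integral_add (integrable_const _) hiA, integral_const_mul,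
          integral_const_mul, hIX, hIY, integral_const, probReal_univ, one_smul]
    _ = 2 * (a₁ + a₂ + a₃) / b := by field_simp; ring
    _ ≤ 2 := by rw [← hba, mul_div_cancel_right₀ _ hb0.ne']
end

section
/- Fix D ≥ 1, k ∈ ℝ, a dimension m ≥ 1, an D×m real matrix W and b ∈ ℝ^D, and define f : ℝ^D → ℝ^D by f(x) = D^{k/2}·x/‖x‖ for x ≠ 0 (Euclidean norm). For α > 0 define G_α : ℝ^m → ℝ^D by G_α(v) = f((α·W)·v + α·b). Then for every v ∈ ℝ^m with W·v + b ≠ 0, G_α(v) = G_1(v) and the Fréchet derivative of G_α at v equals the Fréchet derivative of G_1 at v. -/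
/-- Rescaling to a fixed norm is invariant under positive scaling. -/
theorem norm_rescale_smul {E : Type*} [NormedAddCommGroup E] [NormedSpace ℝ E]
    (c : ℝ) {α : ℝ} (hα : 0 < α) (x : E) :
    (c * ‖α • x‖⁻¹) • (α • x) = (c * ‖x‖⁻¹) • x := by
  rw [smul_smul, norm_smul, Real.norm_of_nonneg hα.le, mul_inv]
  congr 1
  field_simp

/-- Multiplying the affine parameters `(W, b)` by a positive scalar `α` leaves
both the UnitNorm output `G_α(v) = f((αW)v + αb)` and its gradient with respect
to the input `v` unchanged. -/
theorem unitNorm_input_gradient_invariant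
    (D : ℕ) (hD : 1 ≤ D) (k : ℝ) (m : ℕ) (hm : 1 ≤ m)
    (W : Fin D → Fin m → ℝ) (b : EuclideanSpace ℝ (Fin D))
    (f : EuclideanSpace ℝ (Fin D) → EuclideanSpace ℝ (Fin D))
    (hf : ∀ x, f x = ((D : ℝ) ^ (k / 2) * ‖x‖⁻¹) • x)
    (G : ℝ → EuclideanSpace ℝ (Fin m) → EuclideanSpace ℝ (Fin D))
    (hG : ∀ α v, G α v
      = f ((WithLp.equiv 2 (Fin D → ℝ)).symm
            (fun i => ∑ j, (α * W i j) * (WithLp.equiv 2 (Fin m → ℝ)) v j)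
          + α • b))
    (α : ℝ) (hα : 0 < α)
    (v : EuclideanSpace ℝ (Fin m))
    (hWvb : (WithLp.equiv 2 (Fin D → ℝ)).symm
        (fun i => ∑ j, W i j * (WithLp.equiv 2 (Fin m → ℝ)) v j) + b ≠ 0) :
    G α v = G 1 v ∧ fderiv ℝ (G α) v = fderiv ℝ (G 1) v := by
  have hscale : ∀ β : ℝ, 0 < β → ∀ w, G β w
      = f ((WithLp.equiv 2 (Fin D → ℝ)).symm
            (fun i => ∑ j, W i j * (WithLp.equiv 2 (Fin m → ℝ)) w j) + b) := by
    intro β hβ w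
    have hlin : (WithLp.equiv 2 (Fin D → ℝ)).symm
          (fun i => ∑ j, (β * W i j) * (WithLp.equiv 2 (Fin m → ℝ)) w j)
        = β • (WithLp.equiv 2 (Fin D → ℝ)).symm
          (fun i => ∑ j, W i j * (WithLp.equiv 2 (Fin m → ℝ)) w j) := by
      ext i
      simp [Finset.mul_sum, mul_assoc]
    rw [hG, hlin, ← smul_add, hf, hf, norm_rescale_smul _ hβ]
  have hG_eq : G α = G 1 := funext fun w => by rw [hscale α hα, hscale 1 one_pos]
  exact ⟨congrFun hG_eq v, by rw [hG_eq]⟩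
end

section
/- Let L ≥ 2 and D ≥ 2 be integers, and define ELB(k; L, D) := log(L − 1 + exp(2·D^{k − 1/2})) − (2·D^{k − 1/2}·exp(2·D^{k − 1/2})) / (L − 1 + exp(2·D^{k − 1/2})) for k ∈ ℝ. Then ELB(k; L, D) is strictly monotonically decreasing as a function of k ∈ ℝ. -/
/-- The derivative of `x ↦ log (a + exp x) - x * exp x / (a + exp x)` for positive `a`. -/
theorem hasDerivAt_log_add_exp_sub {a : ℝ} (ha : 0 < a) (x : ℝ) :
    HasDerivAt (fun x : ℝ => Real.log (a + Real.exp x) - x * Real.exp x / (a + Real.exp x))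
      (-(a * x * Real.exp x / (a + Real.exp x) ^ 2)) x := by
  have hne : a + Real.exp x ≠ 0 := by positivity
  have hs : HasDerivAt (fun x : ℝ => a + Real.exp x) (Real.exp x) x :=
    (Real.hasDerivAt_exp x).const_add a
  have hm : HasDerivAt (fun x : ℝ => x * Real.exp x) (1 * Real.exp x + x * Real.exp x) x :=
    (hasDerivAt_id' x).mul (Real.hasDerivAt_exp x)
  refine ((hs.log hne).sub (hm.div hs hne)).congr_deriv ?_
  field_simp
  ring

theorem strictAntiOn_log_add_exp_sub {a : ℝ} (ha : 0 < a) :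
    StrictAntiOn (fun x : ℝ => Real.log (a + Real.exp x) - x * Real.exp x / (a + Real.exp x))
      (Set.Ici 0) := by
  refine strictAntiOn_of_deriv_neg (convex_Ici 0)
    (fun x _ => (hasDerivAt_log_add_exp_sub ha x).continuousAt.continuousWithinAt) fun x hx => ?_
  rw [interior_Ici, Set.mem_Ioi] at hx
  rw [(hasDerivAt_log_add_exp_sub ha x).deriv, neg_lt_zero]
  positivity


/-- `ELB(k; L, D)` is strictly monotonically decreasing in `k` for `L ≥ 2`, `D ≥ 2`. -/
theorem elb_strictAnti
    (L D : ℕ) (hL : 2 ≤ L) (hD : 2 ≤ D) :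
    StrictAnti (fun k : ℝ =>
      Real.log ((L : ℝ) - 1 + Real.exp (2 * (D : ℝ) ^ (k - 1 / 2)))
        - 2 * (D : ℝ) ^ (k - 1 / 2) * Real.exp (2 * (D : ℝ) ^ (k - 1 / 2))
          / ((L : ℝ) - 1 + Real.exp (2 * (D : ℝ) ^ (k - 1 / 2)))) := by
  intro k₁ k₂ hk
  have hL' : (0 : ℝ) < (L : ℝ) - 1 := by
    have : (2 : ℝ) ≤ L := by exact_mod_cast hL
    linarith
  have hD' : (1 : ℝ) < D := by exact_mod_cast hD
  have hlt : 2 * (D : ℝ) ^ (k₁ - 1 / 2) < 2 * (D : ℝ) ^ (k₂ - 1 / 2) := by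
    have := Real.rpow_lt_rpow_of_exponent_lt hD' (sub_lt_sub_right hk (1 / 2))
    linarith
  exact strictAntiOn_log_add_exp_sub hL' (Set.mem_Ici.2 (by positivity))
    (Set.mem_Ici.2 (by positivity)) hlt
end

section
/- Let L ≥ 2 and D ≥ 2 be integers, and define ELB(k; L, D) := log(L − 1 + exp(2·D^{k − 1/2})) − (2·D^{k − 1/2}·exp(2·D^{k − 1/2})) / (L − 1 + exp(2·D^{k − 1/2})) for k ∈ ℝ. Then lim_{k → +∞} ELB(k; L, D) = 0. -/
open Filter

theorem tendsto_log_add_exp_sub_mul_exp_div_atTop {c : ℝ} (hc : 0 ≤ c) :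
    Tendsto (fun d : ℝ => Real.log (c + Real.exp d) - d * Real.exp d / (c + Real.exp d))
      atTop (nhds 0) := by
  have h_exp : Tendsto (fun d : ℝ => 1 + c * Real.exp (-d)) atTop (nhds 1) := by
    simpa using (Real.tendsto_exp_neg_atTop_nhds_zero.const_mul c).const_add 1
  have h_mul : Tendsto (fun d : ℝ => d * Real.exp (-d)) atTop (nhds 0) := by
    simpa using Real.tendsto_pow_mul_exp_neg_atTop_nhds_zero 1
  have h_sum : Tendsto (fun d : ℝ => Real.log (1 + c * Real.exp (-d))
      + c * (d * Real.exp (-d)) / (1 + c * Real.exp (-d))) atTop (nhds 0) := by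
    simpa using (h_exp.log one_ne_zero).add ((h_mul.const_mul c).div h_exp one_ne_zero)
  refine h_sum.congr fun d => ?_
  have h_pos : 0 < 1 + c * Real.exp (-d) := by positivity
  have h_factor : c + Real.exp d = Real.exp d * (1 + c * Real.exp (-d)) := by
    rw [Real.exp_neg]
    field_simp
    ring
  rw [h_factor, Real.log_mul (Real.exp_ne_zero d) h_pos.ne', Real.log_exp]
  have h_ne := Real.exp_ne_zero d
  field_simp
  ring

/-- As `k → +∞`, `ELB(k; L, D)` tends to `0`. -/
theorem elb_tendsto_atTop
    (L D : ℕ) (hL : 2 ≤ L) (hD : 2 ≤ D) :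
    Tendsto (fun k : ℝ =>
      Real.log ((L : ℝ) - 1 + Real.exp (2 * (D : ℝ) ^ (k - 1 / 2)))
        - 2 * (D : ℝ) ^ (k - 1 / 2) * Real.exp (2 * (D : ℝ) ^ (k - 1 / 2))
          / ((L : ℝ) - 1 + Real.exp (2 * (D : ℝ) ^ (k - 1 / 2))))
      atTop (nhds 0) := by
  have hL' : (2 : ℝ) ≤ L := by exact_mod_cast hL
  have hD' : (2 : ℝ) ≤ D := by exact_mod_cast hD
  have h_rpow : Tendsto (fun k : ℝ => (D : ℝ) ^ (k - 1 / 2)) atTop atTop :=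
    (tendsto_rpow_atTop_of_base_gt_one (D : ℝ) (by linarith)).comp
      (tendsto_atTop_add_const_right atTop (-(1 / 2 : ℝ)) tendsto_id)
  exact (tendsto_log_add_exp_sub_mul_exp_div_atTop (by linarith : (0 : ℝ) ≤ L - 1)).comp
    (h_rpow.const_mul_atTop two_pos)
end

section
/- Let L ≥ 2 and D ≥ 1 be integers, and define ELB(k; L, D) := log(L − 1 + exp(2·D^{k − 1/2})) − (2·D^{k − 1/2}·exp(2·D^{k − 1/2})) / (L − 1 + exp(2·D^{k − 1/2})) for k ∈ ℝ. Then for every k ∈ ℝ, 0 < ELB(k; L, D) < log L. -/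
/-- The entropy of the softmax of `(d, 0, …, 0)`, with `m` zeros, is positive. -/
theorem log_add_exp_sub_pos {m d : ℝ} (hm : 0 < m) (hd : 0 < d) :
    0 < Real.log (m + Real.exp d) - d * Real.exp d / (m + Real.exp d) := by
  have he := Real.exp_pos d
  have hlog : d < Real.log (m + Real.exp d) := by
    rw [Real.lt_log_iff_exp_lt (by positivity)]
    linarith
  have hdiv : d * Real.exp d / (m + Real.exp d) < d := by
    rw [div_lt_iff₀ (by positivity)]
    nlinarith [mul_pos hd hm]
  linarith

/-- The entropy of the softmax of `(d, 0, …, 0)`, with `m` zeros, is less than that of the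
uniform distribution. -/
theorem log_add_exp_sub_lt_log {m d : ℝ} (hm : 0 < m) (hd : 0 < d) :
    Real.log (m + Real.exp d) - d * Real.exp d / (m + Real.exp d) < Real.log (m + 1) := by
  have he := Real.exp_pos d
  have he1 : 1 < Real.exp d := Real.one_lt_exp_iff.mpr hd
  have hS : 0 < m + Real.exp d := by positivity
  have hL : 0 < m + 1 := by positivity
  have hne : (m + Real.exp d) / (m + 1) ≠ 1 := by
    rw [Ne, div_eq_one_iff_eq hL.ne']
    linarith
  have hzero := Real.log_lt_sub_one_of_pos (div_pos hS hL) hne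
  have hpeak := Real.log_le_sub_one_of_pos (div_pos (div_pos hS hL) he)
  rw [Real.log_div (div_pos hS hL).ne' he.ne', Real.log_exp] at hpeak
  rw [Real.log_div hS.ne' hL.ne'] at hzero hpeak
  have hzero' := mul_lt_mul_of_pos_left hzero hm
  have hpeak' := mul_le_mul_of_nonneg_left hpeak he.le
  have hsum : m * ((m + Real.exp d) / (m + 1) - 1)
      + Real.exp d * ((m + Real.exp d) / (m + 1) / Real.exp d - 1) = 0 := by
    field_simp
    ring
  rw [sub_lt_comm, lt_div_iff₀ hS]
  linarith

/-- For every `k`, the entropy lower bound `ELB(k; L, D)` lies strictly between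
`0` and `log L`. -/
theorem elb_bounds
    (L D : ℕ) (hL : 2 ≤ L) (hD : 1 ≤ D) (k : ℝ) :
    0 < Real.log ((L : ℝ) - 1 + Real.exp (2 * (D : ℝ) ^ (k - 1 / 2)))
        - 2 * (D : ℝ) ^ (k - 1 / 2) * Real.exp (2 * (D : ℝ) ^ (k - 1 / 2))
          / ((L : ℝ) - 1 + Real.exp (2 * (D : ℝ) ^ (k - 1 / 2))) ∧
      Real.log ((L : ℝ) - 1 + Real.exp (2 * (D : ℝ) ^ (k - 1 / 2)))
        - 2 * (D : ℝ) ^ (k - 1 / 2) * Real.exp (2 * (D : ℝ) ^ (k - 1 / 2))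
          / ((L : ℝ) - 1 + Real.exp (2 * (D : ℝ) ^ (k - 1 / 2)))
        < Real.log L := by
  have hL' : (2 : ℝ) ≤ L := by exact_mod_cast hL
  have hD' : (0 : ℝ) < D := by exact_mod_cast hD
  have hm : (0 : ℝ) < L - 1 := by linarith
  have hd : 0 < 2 * (D : ℝ) ^ (k - 1 / 2) := by positivity
  have hlt := log_add_exp_sub_lt_log hm hd
  rw [sub_add_cancel] at hlt
  exact ⟨log_add_exp_sub_pos hm hd, hlt⟩
end
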